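/- Let L be a domain, let E be a quasisober topological space, and let ν be an L-valued maxitive measure on the Borel σ-algebra ℬ of E. Then ν is tight and regular if and only if ν has an upper compact usc cardinal density. -/

import Mathlib

open Set

universe u v

section OrderDefs
variable {L : Type u} [PartialOrder L]

/-- A filtered (nonempty, downward directed) subset of a poset. -/
def DirFiltered (F : Set L) : Prop :=
  F.Nonempty ∧ ∀ r ∈ F, ∀ s ∈ F, ∃ t ∈ F, t ≤ r ∧ t ≤ s

/-- A filter of a poset: a filtered upper set. -/
def OrdFilter (F : Set L) : Prop :=
  DirFiltered F ∧ ∀ r ∈ F, ∀ s : L, r ≤ s → s ∈ F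

/-- Every filter has an infimum. -/
def FilteredComplete (L : Type u) [PartialOrder L] : Prop :=
  ∀ F : Set L, OrdFilter F → ∃ i : L, IsGLB F i

/-- `s` is way-above `r`: for every filter `F` with an infimum below `r`, `s ∈ F`. -/
def WayAbove (s r : L) : Prop :=
  ∀ F : Set L, OrdFilter F → ∀ i : L, IsGLB F i → i ≤ r → s ∈ F

/-- The poset is continuous: for every `r`, the set of elements way-above `r`
is a filter whose infimum is `r`. -/
def ContinuousPoset (L : Type u) [PartialOrder L] : Prop :=
  ∀ r : L, OrdFilter {s : L | WayAbove s r} ∧ IsGLB {s : L | WayAbove s r} r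

/-- Conditional completeness: every nonempty set bounded above has a supremum. -/
def CondComplete (L : Type u) [PartialOrder L] : Prop :=
  ∀ S : Set L, S.Nonempty → BddAbove S → ∃ m : L, IsLUB S m

end OrderDefs

/-- A domain: a filtered-complete continuous poset with a least element. -/
def DomainPoset (L : Type u) [PartialOrder L] [OrderBot L] : Prop :=
  FilteredComplete L ∧ ContinuousPoset L

section TopDefs
variable {E : Type v} [TopologicalSpace E]

/-- The saturation of a set: intersection of all open sets containing it. -/
def satur (A : Set E) : Set E := ⋂₀ {G : Set E | IsOpen G ∧ A ⊆ G}

/-- A set is saturated if it is an intersection of open sets. -/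
def IsSatur (A : Set E) : Prop :=
  ∃ 𝒢 : Set (Set E), (∀ G ∈ 𝒢, IsOpen G) ∧ A = ⋂₀ 𝒢

/-- The collection 𝒬 of compact saturated subsets. -/
def CompactSat (E : Type v) [TopologicalSpace E] : Set (Set E) :=
  {A : Set E | IsCompact A ∧ IsSatur A}

/-- The Borel σ-algebra generated by open sets and compact saturated sets. -/
def BorelM (E : Type v) [TopologicalSpace E] : MeasurableSpace E :=
  MeasurableSpace.generateFrom ({A : Set E | IsOpen A} ∪ CompactSat E)

/-- Borel subsets for the σ-algebra generated by opens and compact saturated sets. -/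
def IsBorelSet (B : Set E) : Prop := @MeasurableSet E (BorelM E) B

/-- The collection 𝒦 of compact Borel subsets. -/
def CompactBorel (E : Type v) [TopologicalSpace E] : Set (Set E) :=
  {A : Set E | IsBorelSet A ∧ IsCompact A}

/-- `[x]` : the compact Borel set `↑{x} ∩ closure {x}`. -/
def ptClass (x : E) : Set E := satur {x} ∩ closure {x}

end TopDefs

section MeasDefs
variable {L : Type u} {E : Type v} [PartialOrder L] [OrderBot L] [TopologicalSpace E]

/-- An L-valued maxitive measure on the Borel σ-algebra. -/
def Maxitive (ν : Set E → L) : Prop :=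
  ν ∅ = ⊥ ∧ ∀ 𝒞 : Set (Set E), 𝒞.Finite → (∀ B ∈ 𝒞, IsBorelSet B) →
    IsLUB (ν '' 𝒞) (ν (⋃₀ 𝒞))

/-- σ-maxitivity. -/
def SigmaMaxitive (ν : Set E → L) : Prop :=
  Maxitive ν ∧ ∀ 𝒞 : Set (Set E), 𝒞.Countable → (∀ B ∈ 𝒞, IsBorelSet B) →
    IsLUB (ν '' 𝒞) (ν (⋃₀ 𝒞))

/-- Complete maxitivity. -/
def CompletelyMaxitive (ν : Set E → L) : Prop :=
  Maxitive ν ∧ ∀ 𝒞 : Set (Set E), (∀ B ∈ 𝒞, IsBorelSet B) → IsBorelSet (⋃₀ 𝒞) →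
    IsLUB (ν '' 𝒞) (ν (⋃₀ 𝒞))

/-- The set `{ν G : G open, G ⊇ B}`. -/
def outerVals (ν : Set E → L) (B : Set E) : Set L :=
  {l : L | ∃ G : Set E, IsOpen G ∧ B ⊆ G ∧ ν G = l}

/-- `νp` is the map `ν⁺ : B ↦ inf {ν G : G open, G ⊇ B}` on Borel sets. -/
def IsNuPlus (ν νp : Set E → L) : Prop :=
  ∀ B : Set E, IsBorelSet B → IsGLB (outerVals ν B) (νp B)

/-- Outer-continuity. -/
def OuterContinuous (ν : Set E → L) : Prop :=
  ∀ B : Set E, IsBorelSet B → IsGLB (outerVals ν B) (ν B)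

/-- Inner-continuity. -/
def InnerContinuous (ν : Set E → L) : Prop :=
  ∀ B : Set E, IsBorelSet B →
    IsLUB {l : L | ∃ K : Set E, IsBorelSet K ∧ IsCompact K ∧ K ⊆ B ∧ ν (satur K) = l} (ν B)

/-- Regularity: inner- and outer-continuity. -/
def RegularMeasure (ν : Set E → L) : Prop :=
  InnerContinuous ν ∧ OuterContinuous ν

/-- Weak outer-continuity: `ν K = ν⁺ K` for every compact Borel `K`. -/
def WeaklyOuterContinuous (ν : Set E → L) : Prop :=
  ∀ K : Set E, IsBorelSet K → IsCompact K → IsGLB (outerVals ν K) (ν K)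

/-- Weak inner-continuity (relative to a given `ν⁺ = νp`). -/
def WeaklyInnerContinuous (ν νp : Set E → L) : Prop :=
  ∀ G : Set E, IsOpen G →
    IsLUB {l : L | ∃ K : Set E, IsBorelSet K ∧ IsCompact K ∧ K ⊆ G ∧ νp K = l} (ν G)

/-- 𝒜-smoothness. -/
def SmoothWrt (ν : Set E → L) (𝒜 : Set (Set E)) : Prop :=
  ∀ 𝒟 : Set (Set E), 𝒟.Nonempty → 𝒟 ⊆ 𝒜 → DirectedOn (· ⊇ ·) 𝒟 →
    IsGLB (ν '' 𝒟) (ν (⋂₀ 𝒟))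

/-- Saturation of a maxitive measure: `ν K = ν (↑K)` for compact Borel `K`. -/
def SaturatedMeasure (ν : Set E → L) : Prop :=
  ∀ K : Set E, IsBorelSet K → IsCompact K → ν K = ν (satur K)

/-- Tightness: `inf {ν (E ∖ K) : K compact Borel} = 0`. -/
def TightMeasure (ν : Set E → L) : Prop :=
  IsGLB {l : L | ∃ K : Set E, IsBorelSet K ∧ IsCompact K ∧ ν Kᶜ = l} (⊥ : L)

/-- `c` is a cardinal density of `ν`. -/
def IsCardinalDensity (ν : Set E → L) (c : E → L) : Prop :=
  ∀ B : Set E, IsBorelSet B → IsLUB (c '' B) (ν B)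

/-- Upper semicontinuity of a map into the poset. -/
def UscMap (c : E → L) : Prop := ∀ t : L, IsOpen {x : E | WayAbove t (c x)}

/-- Upper compactness of a map into the poset. -/
def UpperCompactMap (c : E → L) : Prop :=
  ∀ t : L, WayAbove t (⊥ : L) → IsCompact {x : E | ¬ WayAbove t (c x)}

/-- Continuity from above along decreasing sequences of Borel sets. -/
def ContinuousFromAbove (ν : Set E → L) : Prop :=
  ∀ B : ℕ → Set E, (∀ n, IsBorelSet (B n)) → (∀ n, B (n + 1) ⊆ B n) →
    IsGLB (Set.range fun n => ν (B n)) (ν (⋂ n, B n))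

/-- An optimal measure: a σ-maxitive measure continuous from above. -/
def OptimalMeasure (ν : Set E → L) : Prop :=
  SigmaMaxitive ν ∧ ContinuousFromAbove ν

/-- `flo` is the regular part `⌊ν⌋` (relative to `νp = ν⁺`):
`⌊ν⌋(B) = sup {ν⁺(K) : K compact Borel, K ⊆ B}`. -/
def RegPartRel (νp flo : Set E → L) : Prop :=
  ∀ B : Set E, IsBorelSet B →
    IsLUB {l : L | ∃ K : Set E, IsBorelSet K ∧ IsCompact K ∧ K ⊆ B ∧ νp K = l} (flo B)

end MeasDefs

section OrderLemmas
variable {L : Type u} [PartialOrder L]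

theorem WayAbove.mono {s s' r r' : L} (h : WayAbove s r) (hs : s ≤ s') (hr : r' ≤ r) :
    WayAbove s' r' := fun F hF i hi hir =>
  hF.2 s (h F hF i hi (hir.trans hr)) s' hs

theorem ContinuousPoset.le_of_wayAbove (hL : ContinuousPoset L) {s r : L} (h : WayAbove s r) :
    r ≤ s := (hL r).2.1 h

theorem ContinuousPoset.le_of_forall_wayAbove (hL : ContinuousPoset L) {l r : L}
    (h : ∀ t, WayAbove t r → l ≤ t) : l ≤ r := (hL r).2.2 fun t ht => h t ht

/-- The upper closure of a filtered set is a filter. -/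
theorem DirFiltered.ordFilter_upperClosure {S : Set L} (hS : DirFiltered S) :
    OrdFilter {u : L | ∃ v ∈ S, v ≤ u} := by
  refine ⟨⟨hS.1.imp fun v hv => ⟨v, hv, le_rfl⟩, ?_⟩, ?_⟩
  · rintro r ⟨v, hv, hvr⟩ s ⟨w, hw, hws⟩
    obtain ⟨t, ht, htv, htw⟩ := hS.2 v hv w hw
    exact ⟨t, ⟨t, ht, le_rfl⟩, htv.trans hvr, htw.trans hws⟩
  · rintro r ⟨v, hv, hvr⟩ s hrs
    exact ⟨v, hv, hvr.trans hrs⟩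

theorem isGLB_upperClosure_iff {S : Set L} {i : L} :
    IsGLB {u : L | ∃ v ∈ S, v ≤ u} i ↔ IsGLB S i := by
  have : lowerBounds {u : L | ∃ v ∈ S, v ≤ u} = lowerBounds S := by
    ext l
    exact ⟨fun h v hv => h ⟨v, hv, le_rfl⟩, fun h u ⟨v, hv, hvu⟩ => (h hv).trans hvu⟩
  rw [IsGLB, IsGLB, this]

theorem WayAbove.exists_mem_le {S : Set L} (hS : DirFiltered S) {s i : L} (hi : IsGLB S i)
    (h : WayAbove s i) : ∃ v ∈ S, v ≤ s :=
  h _ hS.ordFilter_upperClosure i (isGLB_upperClosure_iff.2 hi) le_rfl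

theorem FilteredComplete.exists_isGLB (hL : FilteredComplete L) {S : Set L} (hS : DirFiltered S) :
    ∃ i, IsGLB S i :=
  (hL _ hS.ordFilter_upperClosure).imp fun _ => isGLB_upperClosure_iff.1

/-- The interpolation property of the way-above relation. -/
theorem WayAbove.interpolate (hL : ContinuousPoset L) {s r : L} (h : WayAbove s r) :
    ∃ t, WayAbove s t ∧ WayAbove t r := by
  refine h {u | ∃ t, WayAbove u t ∧ WayAbove t r} ⟨⟨?_, ?_⟩, ?_⟩ r ⟨?_, ?_⟩ le_rfl
  · obtain ⟨t, ht⟩ := (hL r).1.1.1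
    obtain ⟨u, hu⟩ := (hL t).1.1.1
    exact ⟨u, t, hu, ht⟩
  · rintro u ⟨t, hut, htr⟩ u' ⟨t', hut', htr'⟩
    obtain ⟨q, hq, hqt, hqt'⟩ := (hL r).1.1.2 t htr t' htr'
    obtain ⟨w, hw, hwu, hwu'⟩ :=
      (hL q).1.1.2 u (hut.mono le_rfl hqt) u' (hut'.mono le_rfl hqt')
    exact ⟨w, ⟨q, hw, hq⟩, hwu, hwu'⟩
  · rintro u ⟨t, hut, htr⟩ v huv
    exact ⟨t, hut.mono huv le_rfl, htr⟩
  · rintro u ⟨t, hut, htr⟩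
    exact (hL.le_of_wayAbove htr).trans (hL.le_of_wayAbove hut)
  · intro l hl
    exact hL.le_of_forall_wayAbove fun t ht => hL.le_of_forall_wayAbove fun u hu => hl ⟨t, hu, ht⟩

end OrderLemmas

section TopLemmas
variable {E : Type v} [TopologicalSpace E]

theorem IsOpen.isBorelSet {G : Set E} (hG : IsOpen G) : IsBorelSet G :=
  MeasurableSpace.measurableSet_generateFrom (Or.inl hG)

theorem IsBorelSet.compl {B : Set E} (hB : IsBorelSet B) : IsBorelSet Bᶜ :=
  @MeasurableSet.compl E B (BorelM E) hB

theorem IsClosed.isBorelSet {C : Set E} (hC : IsClosed C) : IsBorelSet C := by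
  simpa using hC.isOpen_compl.isBorelSet.compl

theorem IsBorelSet.union {A B : Set E} (hA : IsBorelSet A) (hB : IsBorelSet B) :
    IsBorelSet (A ∪ B) :=
  @MeasurableSet.union E (BorelM E) A B hA hB

theorem IsBorelSet.inter {A B : Set E} (hA : IsBorelSet A) (hB : IsBorelSet B) :
    IsBorelSet (A ∩ B) :=
  @MeasurableSet.inter E (BorelM E) A B hA hB

theorem subset_satur (A : Set E) : A ⊆ satur A := fun _ hx _ hG => hG.2 hx

theorem satur_subset {A G : Set E} (hG : IsOpen G) (h : A ⊆ G) : satur A ⊆ G :=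
  fun _ hx => hx G ⟨hG, h⟩

theorem isSatur_satur (A : Set E) : IsSatur (satur A) := ⟨_, fun _ hG => hG.1, rfl⟩

theorem IsCompact.satur {K : Set E} (hK : IsCompact K) : IsCompact (satur K) := by
  refine isCompact_of_finite_subcover fun U hU hKU => ?_
  obtain ⟨t, ht⟩ := hK.elim_finite_subcover U hU ((subset_satur K).trans hKU)
  exact ⟨t, satur_subset (isOpen_biUnion fun i _ => hU i) ht⟩

theorem IsCompact.isBorelSet_satur {K : Set E} (hK : IsCompact K) : IsBorelSet (_root_.satur K) :=
  MeasurableSpace.measurableSet_generateFrom (Or.inr ⟨hK.satur, isSatur_satur K⟩)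

theorem exists_specializes_of_mem_satur {K : Set E} {x : E} (hx : x ∈ satur K) :
    ∃ y ∈ K, x ⤳ y := by
  by_contra! h
  have hK : K ⊆ (closure {x})ᶜ := fun y hy hyx => h y hy (specializes_iff_mem_closure.2 hyx)
  exact satur_subset isClosed_closure.isOpen_compl hK hx (subset_closure rfl)

theorem isBorelSet_ptClass (x : E) : IsBorelSet (ptClass x) :=
  isCompact_singleton.isBorelSet_satur.inter isClosed_closure.isBorelSet

theorem isCompact_ptClass (x : E) : IsCompact (ptClass x) :=
  isCompact_singleton.satur.inter_right isClosed_closure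

theorem mem_ptClass_self (x : E) : x ∈ ptClass x := ⟨subset_satur _ rfl, subset_closure rfl⟩

theorem inseparable_of_mem_ptClass {x y : E} (h : y ∈ ptClass x) : Inseparable x y := by
  obtain ⟨z, rfl, hz⟩ := exists_specializes_of_mem_satur h.1
  exact (specializes_iff_mem_closure.2 h.2).antisymm hz

/-- Borel sets do not separate inseparable points. -/
theorem IsBorelSet.mem_iff_of_inseparable {B : Set E} (hB : IsBorelSet B) {x y : E}
    (h : Inseparable x y) : x ∈ B ↔ y ∈ B := by
  induction B, hB using MeasurableSpace.generateFrom_induction with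
  | hC B hB _ =>
    rcases hB with hB | ⟨-, 𝒢, h𝒢, rfl⟩
    · exact h.mem_open_iff hB
    · exact forall₂_congr fun G hG => h.mem_open_iff (h𝒢 G hG)
  | empty => simp
  | compl B _ ih => exact not_congr ih
  | iUnion f _ ih => simp only [mem_iUnion, ih]

theorem IsBorelSet.ptClass_subset {B : Set E} (hB : IsBorelSet B) {x : E} (hx : x ∈ B) :
    ptClass x ⊆ B := fun _ hy => (hB.mem_iff_of_inseparable (inseparable_of_mem_ptClass hy)).1 hx

end TopLemmas

section DensityLemmas
variable {L : Type u} {E : Type v} [PartialOrder L] [TopologicalSpace E] {ν : Set E → L}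

theorem UscMap.le_of_specializes (hL : ContinuousPoset L) {c : E → L} (hc : UscMap c) {x y : E}
    (h : x ⤳ y) : c x ≤ c y :=
  hL.le_of_forall_wayAbove fun t ht => hL.le_of_wayAbove (h.mem_open (hc t) ht)

theorem IsCardinalDensity.le_of_forall_wayAbove (hL : ContinuousPoset L) {c : E → L}
    (hd : IsCardinalDensity ν c) {B : Set E} (hB : IsBorelSet B) {t : L}
    (h : ∀ x ∈ B, WayAbove t (c x)) : ν B ≤ t := by
  refine (hd B hB).2 ?_
  rintro _ ⟨x, hx, rfl⟩
  exact hL.le_of_wayAbove (h x hx)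

theorem IsCardinalDensity.regularMeasure (hL : ContinuousPoset L) {c : E → L}
    (hd : IsCardinalDensity ν c) (hc : UscMap c) : RegularMeasure ν := by
  have hmono {A B : Set E} (hA : IsBorelSet A) (hB : IsBorelSet B) (h : A ⊆ B) : ν A ≤ ν B :=
    (hd A hA).mono (hd B hB) (image_mono h)
  refine ⟨fun B hB => ⟨?_, fun u hu => ?_⟩, fun B hB => ⟨?_, fun l hl => ?_⟩⟩
  · rintro _ ⟨K, -, hKc, hKB, rfl⟩
    refine (hd _ hKc.isBorelSet_satur).2 ?_
    rintro _ ⟨x, hx, rfl⟩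
    obtain ⟨y, hy, hxy⟩ := exists_specializes_of_mem_satur hx
    exact (hc.le_of_specializes hL hxy).trans ((hd B hB).1 ⟨y, hKB hy, rfl⟩)
  · refine (hd B hB).2 ?_
    rintro _ ⟨x, hx, rfl⟩
    have hxc := isCompact_ptClass x
    exact ((hd _ hxc.isBorelSet_satur).1 ⟨x, subset_satur _ (mem_ptClass_self x), rfl⟩).trans
      (hu ⟨ptClass x, isBorelSet_ptClass x, hxc, hB.ptClass_subset hx, rfl⟩)
  · rintro _ ⟨G, hG, hBG, rfl⟩
    exact hmono hB hG.isBorelSet hBG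
  · refine hL.le_of_forall_wayAbove fun t ht => ?_
    refine (hl ⟨{x | WayAbove t (c x)}, hc t, fun x hx => ?_, rfl⟩).trans
      (hd.le_of_forall_wayAbove hL (hc t).isBorelSet fun x hx => hx)
    exact ht.mono le_rfl ((hd B hB).1 ⟨x, hx, rfl⟩)

end DensityLemmas

section MeasLemmas
variable {L : Type u} {E : Type v} [PartialOrder L] [OrderBot L] [TopologicalSpace E]
  {ν : Set E → L}

theorem Maxitive.mono (hν : Maxitive ν) {A B : Set E} (hA : IsBorelSet A) (hB : IsBorelSet B)
    (h : A ⊆ B) : ν A ≤ ν B := by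
  have := (hν.2 {A, B} (by simp) (by simp [hA, hB])).1 ⟨A, by simp, rfl⟩
  rwa [sUnion_pair, union_eq_self_of_subset_left h] at this

theorem Maxitive.dirFiltered_open (hν : Maxitive ν) (x : E) :
    DirFiltered (ν '' {G | IsOpen G ∧ x ∈ G}) := by
  refine ⟨⟨_, univ, ⟨isOpen_univ, mem_univ x⟩, rfl⟩, ?_⟩
  rintro _ ⟨G, ⟨hG, hxG⟩, rfl⟩ _ ⟨H, ⟨hH, hxH⟩, rfl⟩
  exact ⟨_, ⟨G ∩ H, ⟨hG.inter hH, hxG, hxH⟩, rfl⟩,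
    hν.mono (hG.inter hH).isBorelSet hG.isBorelSet inter_subset_left,
    hν.mono (hG.inter hH).isBorelSet hH.isBorelSet inter_subset_right⟩

theorem Maxitive.dirFiltered_compl_compact (hν : Maxitive ν) :
    DirFiltered {l : L | ∃ K : Set E, IsBorelSet K ∧ IsCompact K ∧ ν Kᶜ = l} := by
  refine ⟨⟨_, ∅, isOpen_empty.isBorelSet, isCompact_empty, rfl⟩, ?_⟩
  rintro _ ⟨K, hK, hKc, rfl⟩ _ ⟨M, hM, hMc, rfl⟩
  exact ⟨_, ⟨K ∪ M, hK.union hM, hKc.union hMc, rfl⟩,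
    hν.mono (hK.union hM).compl hK.compl (compl_subset_compl.2 subset_union_left),
    hν.mono (hK.union hM).compl hM.compl (compl_subset_compl.2 subset_union_right)⟩

/-- If a compact set is covered by open sets of measure at most `t`, so is its saturation. -/
theorem Maxitive.satur_le_of_forall_exists_open (hν : Maxitive ν) {K : Set E} (hK : IsCompact K)
    {t : L} (h : ∀ x ∈ K, ∃ G, IsOpen G ∧ x ∈ G ∧ ν G ≤ t) : ν (satur K) ≤ t := by
  obtain ⟨𝒯, h𝒯, hfin, hcov⟩ :=
    hK.elim_finite_subcover_image (b := {G | IsOpen G ∧ ν G ≤ t}) (c := id) (fun G hG => hG.1)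
      (fun x hx => by
        obtain ⟨G, hG, hxG, hGt⟩ := h x hx
        exact mem_biUnion (show G ∈ {G | IsOpen G ∧ ν G ≤ t} from ⟨hG, hGt⟩) hxG)
  have ho : IsOpen (⋃₀ 𝒯) := isOpen_sUnion fun G hG => (h𝒯 hG).1
  have hs : K ⊆ ⋃₀ 𝒯 := by rwa [sUnion_eq_biUnion]
  refine (hν.mono hK.isBorelSet_satur ho.isBorelSet (satur_subset ho hs)).trans ?_
  refine (hν.2 𝒯 hfin fun G hG => (h𝒯 hG).1.isBorelSet).2 ?_
  rintro _ ⟨G, hG, rfl⟩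
  exact (h𝒯 hG).2

/-- A tight regular maxitive measure has the density `x ↦ inf {ν G : G open, x ∈ G}`, which is
upper compact and usc. -/
theorem Maxitive.exists_density_of_tight_regular (hL : DomainPoset L) (hν : Maxitive ν)
    (ht : TightMeasure ν) (hr : RegularMeasure ν) :
    ∃ c : E → L, UpperCompactMap c ∧ UscMap c ∧ IsCardinalDensity ν c := by
  choose c hc using fun x => hL.1.exists_isGLB (hν.dirFiltered_open x)
  have hcB {B : Set E} (hB : IsBorelSet B) {x : E} (hx : x ∈ B) : c x ≤ ν B := by
    refine (hr.2 B hB).2 ?_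
    rintro _ ⟨G, hG, hBG, rfl⟩
    exact (hc x).1 ⟨G, ⟨hG, hBG hx⟩, rfl⟩
  have hnhds {s : L} {x : E} (h : WayAbove s (c x)) : ∃ G, IsOpen G ∧ x ∈ G ∧ ν G ≤ s := by
    obtain ⟨_, ⟨G, ⟨hG, hxG⟩, rfl⟩, hGs⟩ := h.exists_mem_le (hν.dirFiltered_open x) (hc x)
    exact ⟨G, hG, hxG, hGs⟩
  have husc : UscMap c := by
    intro t
    refine isOpen_iff_forall_mem_open.2 fun x hx => ?_
    obtain ⟨s, hts, hsx⟩ := WayAbove.interpolate hL.2 hx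
    obtain ⟨G, hG, hxG, hGs⟩ := hnhds hsx
    exact ⟨G, fun y hy => hts.mono le_rfl ((hcB hG.isBorelSet hy).trans hGs), hG, hxG⟩
  refine ⟨c, fun t h => ?_, husc, fun B hB => ⟨?_, fun u hu => ?_⟩⟩
  · obtain ⟨s, hts, hs⟩ := WayAbove.interpolate hL.2 h
    obtain ⟨_, ⟨K, hK, hKc, rfl⟩, hKs⟩ := hs.exists_mem_le hν.dirFiltered_compl_compact ht
    refine hKc.of_isClosed_subset (husc t).isClosed_compl fun x hx => ?_
    by_contra hxK
    exact hx (hts.mono le_rfl ((hcB hK.compl hxK).trans hKs))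
  · rintro _ ⟨x, hx, rfl⟩
    exact hcB hB hx
  · refine (hr.1 B hB).2 ?_
    rintro _ ⟨K, -, hKc, hKB, rfl⟩
    refine hL.2.le_of_forall_wayAbove fun t ht => hν.satur_le_of_forall_exists_open hKc
      fun x hx => hnhds (ht.mono le_rfl (hu ⟨x, hKB hx, rfl⟩))

theorem IsCardinalDensity.tightMeasure (hL : ContinuousPoset L) {c : E → L}
    (hd : IsCardinalDensity ν c) (hk : UpperCompactMap c) (hc : UscMap c) : TightMeasure ν := by
  refine ⟨fun _ _ => bot_le, fun l hl => hL.le_of_forall_wayAbove fun t ht => ?_⟩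
  have hcl : IsClosed {x | ¬ WayAbove t (c x)} := (hc t).isClosed_compl
  exact (hl ⟨_, hcl.isBorelSet, hk t ht, rfl⟩).trans
    (hd.le_of_forall_wayAbove hL hcl.isBorelSet.compl fun x hx => not_not.1 hx)

end MeasLemmas

/-- ν is tight and regular iff ν has an upper compact usc cardinal density. -/
theorem stmt2 {L : Type u} {E : Type v} [PartialOrder L] [OrderBot L]
    [TopologicalSpace E] [QuasiSober E] (hL : DomainPoset L)
    (ν : Set E → L) (hν : Maxitive ν) :
    (TightMeasure ν ∧ RegularMeasure ν) ↔
      ∃ c : E → L, UpperCompactMap c ∧ UscMap c ∧ IsCardinalDensity ν c := by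
  constructor
  · rintro ⟨ht, hr⟩
    exact hν.exists_density_of_tight_regular hL ht hr
  · rintro ⟨c, hk, hc, hd⟩
    exact ⟨hd.tightMeasure hL.2 hk hc, hd.regularMeasure hL.2 hc⟩
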